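/- Let f : ℂ → ℂ be analytic on the open lower half-plane ℂ₋ and satisfy the radial Hardy bound from below C := R₋(f) = sup_{−π<φ<0} ∫₀^∞ |f(r e^{iφ})|² dr < ∞. Define F₊ : ℂ₊ → ℂ by F₊(z) = f(−z^{1/2}) · z^{−1/4}, using principal branch powers. Then F₊ is analytic on the open upper half-plane ℂ₊ and satisfies the radial Hardy bound from above R₊(F₊) = sup_{0<φ<π} ∫₀^∞ |F₊(r e^{iφ})|² dr ≤ 2C. -/

import Mathlib

open MeasureTheory Set
open scoped ENNReal

/-- Radial Hardy bound from below: `sup_{−π<φ<0} ∫₀^∞ |f(r e^{iφ})|² dr`. -/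
noncomputable def Rminus (f : ℂ → ℂ) : ℝ≥0∞ :=
  ⨆ φ ∈ Set.Ioo (-Real.pi) (0 : ℝ),
    ∫⁻ r in Set.Ioi (0 : ℝ), (‖f ((r : ℂ) * Complex.exp ((φ : ℂ) * Complex.I))‖₊ : ℝ≥0∞) ^ 2

/-- Radial Hardy bound from above: `sup_{0<φ<π} ∫₀^∞ |f(r e^{iφ})|² dr`. -/
noncomputable def Rplus (f : ℂ → ℂ) : ℝ≥0∞ :=
  ⨆ φ ∈ Set.Ioo (0 : ℝ) Real.pi,
    ∫⁻ r in Set.Ioi (0 : ℝ), (‖f ((r : ℂ) * Complex.exp ((φ : ℂ) * Complex.I))‖₊ : ℝ≥0∞) ^ 2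

/-- On the upper half-plane, `z ↦ -z ^ (1/2)` takes values in the lower half-plane. -/
lemma neg_cpow_half_im_neg {z : ℂ} (hz : 0 < z.im) : (-(z ^ ((1 : ℂ) / 2))).im < 0 := by
  have hz0 : z ≠ 0 := by
    rintro rfl
    simp at hz
  have harg : 0 < z.arg := by
    refine lt_of_le_of_ne (Complex.arg_nonneg_iff.2 hz.le) fun h => ?_
    exact hz.ne' (Complex.arg_eq_zero_iff.1 h.symm).2
  rw [Complex.neg_im, neg_lt_zero, Complex.cpow_def_of_ne_zero hz0, Complex.exp_im]
  have him : (Complex.log z * (1 / 2)).im = z.arg / 2 := by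
    rw [show (1 / 2 : ℂ) = ((1 / 2 : ℝ) : ℂ) by push_cast; rfl, Complex.im_mul_ofReal,
      Complex.log_im]
    ring
  rw [him]
  exact mul_pos (Real.exp_pos _)
    (Real.sin_pos_of_pos_of_lt_pi (by linarith) (by linarith [Complex.arg_le_pi z, Real.pi_pos]))

/-- The principal square root of `s² e^{iφ}`, negated, is `s e^{i(φ/2 - π)}`. -/
lemma neg_cpow_half_sq_mul_exp {s φ : ℝ} (hs : 0 < s) (hφ : φ ∈ Ioo (0 : ℝ) Real.pi) :
    -((((s ^ 2 : ℝ) : ℂ) * Complex.exp ((φ : ℂ) * Complex.I)) ^ ((1 : ℂ) / 2)) =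
      (s : ℂ) * Complex.exp (((φ / 2 - Real.pi : ℝ) : ℂ) * Complex.I) := by
  have hsq : ((s ^ 2 : ℝ) : ℂ) * Complex.exp ((φ : ℂ) * Complex.I) =
      ((s : ℂ) * Complex.exp (((φ / 2 : ℝ) : ℂ) * Complex.I)) ^ 2 := by
    rw [mul_pow, ← Complex.exp_nat_mul]
    push_cast
    congr 2
    ring
  have harg : ((s : ℂ) * Complex.exp (((φ / 2 : ℝ) : ℂ) * Complex.I)).arg = φ / 2 := by
    rw [Complex.arg_real_mul _ hs, Complex.arg_exp_mul_I, toIocMod_eq_self]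
    constructor <;> linarith [hφ.1, hφ.2]
  have hroot := Complex.pow_cpow_nat_inv
    (x := (s : ℂ) * Complex.exp (((φ / 2 : ℝ) : ℂ) * Complex.I)) (n := 2) two_ne_zero
    (by rw [harg]; push_cast; linarith [hφ.1, Real.pi_pos])
    (by rw [harg]; push_cast; linarith [hφ.2])
  rw [hsq, one_div]
  push_cast at hroot ⊢
  rw [hroot, sub_mul, Complex.exp_sub, Complex.exp_pi_mul_I]
  ring

/-- `|(s² e^{iφ})^{-1/4}|² = s⁻¹`. -/
lemma norm_cpow_neg_quarter_sq {s : ℝ} (φ : ℝ) (hs : 0 < s) :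
    ‖(((s ^ 2 : ℝ) : ℂ) * Complex.exp ((φ : ℂ) * Complex.I)) ^ (-(1 : ℂ) / 4)‖ ^ 2 = s⁻¹ := by
  rw [show (-(1 : ℂ) / 4) = ((-1 / 4 : ℝ) : ℂ) by push_cast; rfl, Complex.norm_cpow_real,
    norm_mul, Complex.norm_exp_ofReal_mul_I, mul_one, Complex.norm_real,
    Real.norm_of_nonneg (by positivity), ← Real.rpow_natCast, ← Real.rpow_natCast,
    ← Real.rpow_mul hs.le, ← Real.rpow_mul hs.le, ← Real.rpow_neg_one]
  norm_num

/-- The substitution `r = s²` on the positive half-line. -/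
lemma lintegral_Ioi_comp_sq (g : ℝ → ℝ≥0∞) :
    ∫⁻ r in Ioi (0 : ℝ), g r = ∫⁻ s in Ioi (0 : ℝ), ENNReal.ofReal (2 * s) * g (s ^ 2) := by
  have himage : (fun s : ℝ => s ^ 2) '' Ioi 0 = Ioi 0 := by
    ext r
    constructor
    · rintro ⟨s, hs, rfl⟩
      exact pow_pos (mem_Ioi.1 hs) 2
    · intro hr
      exact ⟨Real.sqrt r, Real.sqrt_pos.2 hr, Real.sq_sqrt (le_of_lt hr)⟩
  have hinj : InjOn (fun s : ℝ => s ^ 2) (Ioi 0) := fun a ha b hb h =>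
    (pow_left_inj₀ (le_of_lt ha) (le_of_lt hb) two_ne_zero).1 h
  have hderiv : ∀ s ∈ Ioi (0 : ℝ), HasDerivWithinAt (fun s : ℝ => s ^ 2) (2 * s) (Ioi 0) s :=
    fun s _ => by simpa using (hasDerivAt_pow 2 s).hasDerivWithinAt
  conv_lhs => rw [← himage]
  rw [lintegral_image_eq_lintegral_abs_deriv_mul measurableSet_Ioi hderiv hinj]
  refine setLIntegral_congr_fun measurableSet_Ioi fun s hs => ?_
  have hs' : (0 : ℝ) < s := hs
  simp only [abs_of_pos (mul_pos two_pos hs')]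

theorem stmt1 (f : ℂ → ℂ)
    (hf : AnalyticOnNhd ℂ f {z : ℂ | z.im < 0})
    (hC : Rminus f < ∞) :
    AnalyticOnNhd ℂ (fun z : ℂ => f (-(z ^ ((1 : ℂ) / 2))) * z ^ (-(1 : ℂ) / 4))
        {z : ℂ | 0 < z.im} ∧
    Rplus (fun z : ℂ => f (-(z ^ ((1 : ℂ) / 2))) * z ^ (-(1 : ℂ) / 4)) ≤ 2 * Rminus f := by
  refine ⟨fun z hz => ?_, iSup₂_le fun φ hφ => ?_⟩
  · have hslit : z ∈ Complex.slitPlane := Or.inr (ne_of_gt hz)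
    have hroot : AnalyticAt ℂ (fun z : ℂ => -(z ^ ((1 : ℂ) / 2))) z :=
      (analyticAt_id.cpow analyticAt_const hslit).neg
    have hcomp : AnalyticAt ℂ (fun z : ℂ => f (-(z ^ ((1 : ℂ) / 2)))) z :=
      AnalyticAt.fun_comp (hf _ (neg_cpow_half_im_neg hz)) hroot
    exact hcomp.mul (analyticAt_id.cpow analyticAt_const hslit)
  · have hangle : φ / 2 - Real.pi ∈ Ioo (-Real.pi) (0 : ℝ) := by
      constructor <;> linarith [hφ.1, hφ.2]
    have hbound : ∫⁻ r in Ioi (0 : ℝ), (‖f ((r : ℂ) *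
        Complex.exp (((φ / 2 - Real.pi : ℝ) : ℂ) * Complex.I))‖₊ : ℝ≥0∞) ^ 2 ≤ Rminus f :=
      le_iSup₂_of_le (φ / 2 - Real.pi) hangle le_rfl
    refine le_trans (le_of_eq ?_) (mul_le_mul_right hbound 2)
    rw [lintegral_Ioi_comp_sq, ← lintegral_const_mul' _ _ ENNReal.ofNat_ne_top]
    refine setLIntegral_congr_fun measurableSet_Ioi fun s hs => ?_
    have hs' : (0 : ℝ) < s := hs
    have hweight : (‖(((s ^ 2 : ℝ) : ℂ) *
        Complex.exp ((φ : ℂ) * Complex.I)) ^ (-(1 : ℂ) / 4)‖₊ : ℝ≥0∞) ^ 2 =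
          ENNReal.ofReal s⁻¹ := by
      rw [← norm_cpow_neg_quarter_sq φ hs', ENNReal.ofReal_pow (norm_nonneg _),
        ofReal_norm, enorm_eq_nnnorm]
    have hcancel : ENNReal.ofReal (2 * s) * ENNReal.ofReal s⁻¹ = 2 := by
      rw [← ENNReal.ofReal_mul (by positivity), mul_assoc, mul_inv_cancel₀ hs'.ne']
      simp
    simp only [nnnorm_mul, ENNReal.coe_mul, mul_pow, neg_cpow_half_sq_mul_exp hs' hφ, hweight]
    rw [mul_left_comm, hcancel, mul_comm]
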